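/- arXiv:1802.06060 — 3 statements merged into one kernel-verified Lean document; each statement's English description precedes it below -/
import Mathlib

section
/- Let G be a labeled weighted graph and Q a rooted query tree with label constraint ψ. Let q_1 = r, q_2, …, q_j be the nodes of the path in Q from the root r to a query node q = q_j, and let c_1, …, c_j ∈ V be such that {c_i, c_{i+1}} ∈ E for every 1 ≤ i < j and, for each 1 ≤ i ≤ j, a subtree match at (q_i, c_i) exists. Then there exists a complete homomorphic match λ of Q in G with λ(q_i) = c_i for all 1 ≤ i ≤ j; in particular λ(q) = c_j. (Hence every node candidate accessed during the top-down search belongs to some homomorphic result pattern: no spurious candidate is ever accessed.) -/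
open Finset
open scoped Classical

noncomputable section

/-- A finite rooted tree on node type `A`, given by its root and parent function. -/
structure QueryTree (A : Type) where
  root : A
  parent : A → A
  parent_root : parent root = root
  reaches : ∀ v : A, ∃ n : ℕ, parent^[n] v = root

variable {V L A : Type}

/-- A (complete) homomorphic match of the query tree `Q` (with label constraint `ψ`)
in the labeled graph `G` (with node labeling `φ`). -/
def IsMatch [Fintype A] [DecidableEq A] (G : SimpleGraph V) (φ : V → L)
    (Q : QueryTree A) (ψ : A → L) (lam : A → V) : Prop :=
  (∀ u : A, φ (lam u) = ψ u) ∧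
    ∀ u : A, u ≠ Q.root → G.Adj (lam u) (lam (Q.parent u))

/-- Weight of a complete homomorphic match: sum of the edge weights of the images of the
query edges (each non-root query node contributes its parent edge). -/
def matchWeight [Fintype A] [DecidableEq A] (w : Sym2 V → ℝ) (Q : QueryTree A)
    (lam : A → V) : ℝ :=
  ∑ u ∈ Finset.univ.filter (fun u : A => u ≠ Q.root), w s(lam u, lam (Q.parent u))

/-- The node set of the subtree `Q_u` of `Q` rooted at `u`: all descendants of `u`. -/
def desc (Q : QueryTree A) (u : A) : Set A := {v | ∃ n : ℕ, Q.parent^[n] v = u}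

/-- A subtree match at `(u, c)`: a homomorphic match of the subtree `Q_u` in `G`
mapping `u` to `c` (values outside `Q_u` are unconstrained). -/
def IsSubtreeMatch [Fintype A] [DecidableEq A] (G : SimpleGraph V) (φ : V → L)
    (Q : QueryTree A) (ψ : A → L) (u : A) (c : V) (μ : A → V) : Prop :=
  μ u = c ∧ (∀ v ∈ desc Q u, φ (μ v) = ψ v) ∧
    ∀ v ∈ desc Q u, v ≠ u → G.Adj (μ v) (μ (Q.parent v))

/-- Weight of a subtree match at `u`: sum of `w` over the images of the edges of `Q_u`. -/
def subtreeWeight [Fintype A] [DecidableEq A] (w : Sym2 V → ℝ) (Q : QueryTree A)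
    (u : A) (μ : A → V) : ℝ :=
  ∑ v ∈ Finset.univ.filter (fun v : A => v ∈ desc Q u ∧ v ≠ u),
    w s(μ v, μ (Q.parent v))

/-- There exists a subtree match at `(u, c)`. -/
def SubtreeMatchExists [Fintype A] [DecidableEq A] (G : SimpleGraph V) (φ : V → L)
    (Q : QueryTree A) (ψ : A → L) (u : A) (c : V) : Prop :=
  ∃ μ : A → V, IsSubtreeMatch G φ Q ψ u c μ

/-- Minimum subtree weight `W(u, c)`: the minimum of the weights of all subtree
matches at `(u, c)` (meaningful whenever such a match exists). -/
def minW [Fintype A] [DecidableEq A] (G : SimpleGraph V) (φ : V → L) (w : Sym2 V → ℝ)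
    (Q : QueryTree A) (ψ : A → L) (u : A) (c : V) : ℝ :=
  sInf {x : ℝ | ∃ μ : A → V, IsSubtreeMatch G φ Q ψ u c μ ∧ subtreeWeight w Q u μ = x}

/-- A rooted prefix of `Q`: contains the root and is closed under taking parents. -/
def IsRootedPrefix (Q : QueryTree A) (S : Finset A) : Prop :=
  Q.root ∈ S ∧ ∀ v ∈ S, Q.parent v ∈ S

/-- Boundary `∂S`: the query nodes outside `S` whose parent lies in `S`. -/
def boundary [Fintype A] [DecidableEq A] (Q : QueryTree A) (S : Finset A) : Finset A :=
  Finset.univ.filter (fun u : A => u ∉ S ∧ Q.parent u ∈ S)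

/-- A partial match on the rooted prefix `S`: a homomorphic match of the induced
subtree `Q[S]` in `G` (values outside `S` are unconstrained). -/
def IsPartialMatch [Fintype A] [DecidableEq A] (G : SimpleGraph V) (φ : V → L)
    (Q : QueryTree A) (ψ : A → L) (S : Finset A) (P : A → V) : Prop :=
  (∀ u ∈ S, φ (P u) = ψ u) ∧ ∀ u ∈ S, u ≠ Q.root → G.Adj (P u) (P (Q.parent u))

/-- The set `{ w({c, c'}) + W(u', c') : c' a neighbor of c, φ(c') = ψ(u'),
a subtree match at (u', c') exists }`. -/
def candSet [Fintype A] [DecidableEq A] (G : SimpleGraph V) (φ : V → L) (w : Sym2 V → ℝ)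
    (Q : QueryTree A) (ψ : A → L) (c : V) (u' : A) : Set ℝ :=
  {x : ℝ | ∃ c' : V, G.Adj c c' ∧ φ c' = ψ u' ∧ SubtreeMatchExists G φ Q ψ u' c' ∧
      x = w s(c, c') + minW G φ w Q ψ u' c'}

/-- Priority of a partial match `P` on the rooted prefix `S`. -/
def priorityVal [Fintype A] [DecidableEq A] (G : SimpleGraph V) (φ : V → L)
    (w : Sym2 V → ℝ) (Q : QueryTree A) (ψ : A → L) (S : Finset A) (P : A → V) : ℝ :=
  (∑ u ∈ S.filter (fun u : A => u ≠ Q.root), w s(P u, P (Q.parent u))) +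
    ∑ u' ∈ boundary Q S, sInf (candSet G φ w Q ψ (P (Q.parent u')) u')


theorem parent_iterate_path (Q : QueryTree A) {j : ℕ} {q : ℕ → A}
    (hpath : ∀ i : ℕ, i + 1 < j → Q.parent (q (i + 1)) = q i ∧ q (i + 1) ≠ Q.root)
    (m i : ℕ) (h : m + i < j) : Q.parent^[m] (q (m + i)) = q i := by
  induction m with
  | zero => simp
  | succ m ih =>
    rw [Function.iterate_succ_apply, show m + 1 + i = m + i + 1 by omega,
      (hpath (m + i) (by omega)).1]
    exact ih (by omega)

theorem path_notMem_desc (Q : QueryTree A) {j : ℕ} {q : ℕ → A} (hroot : q 0 = Q.root)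
    (hpath : ∀ i : ℕ, i + 1 < j → Q.parent (q (i + 1)) = q i ∧ q (i + 1) ≠ Q.root)
    {i k : ℕ} (hik : i < k) (hk : k < j) : q i ∉ desc Q (q k) := by
  have hne : ∀ l, 0 < l → l < j → q l ≠ Q.root := by
    intro l hl hlj
    obtain ⟨l, rfl⟩ := Nat.exists_eq_succ_of_ne_zero hl.ne'
    exact (hpath l hlj).2
  rintro ⟨n, hn⟩
  have hi : Q.parent^[i] (q i) = Q.root := by
    rw [← hroot]
    exact parent_iterate_path Q hpath i 0 (by omega)
  rcases le_or_gt i n with h | h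
  · obtain ⟨m, rfl⟩ := Nat.exists_eq_add_of_le' h
    rw [Function.iterate_add_apply, hi, Function.iterate_fixed Q.parent_root] at hn
    exact hne k (by omega) hk hn.symm
  · obtain ⟨m, rfl⟩ := Nat.exists_eq_add_of_le' h.le
    rw [Function.iterate_add_apply, hn] at hi
    have hm := parent_iterate_path Q hpath m (k - m) (by omega)
    rw [show m + (k - m) = k by omega, hi] at hm
    exact hne (k - m) (by omega) (by omega) hm.symm

theorem mem_desc_self (Q : QueryTree A) (u : A) : u ∈ desc Q u := ⟨0, rfl⟩

theorem mem_desc_of_parent_mem (Q : QueryTree A) {u v : A} (h : Q.parent v ∈ desc Q u) :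
    v ∈ desc Q u := by
  obtain ⟨n, hn⟩ := h
  exact ⟨n + 1, hn⟩

theorem parent_mem_desc (Q : QueryTree A) {u v : A} (h : v ∈ desc Q u) (hv : v ≠ u) :
    Q.parent v ∈ desc Q u := by
  obtain ⟨_ | n, hn⟩ := h
  · exact absurd hn hv
  · exact ⟨n, hn⟩

/-- Replacing a match below `u` by a subtree match at `(u, c)` gives a match, provided `c` is
adjacent to the image of the parent of `u`. -/
theorem IsMatch.piecewise [Fintype A] [DecidableEq A] {G : SimpleGraph V} {φ : V → L}
    {Q : QueryTree A} {ψ : A → L} {lam μ : A → V} {u : A} {c : V}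
    (hlam : IsMatch G φ Q ψ lam) (hμ : IsSubtreeMatch G φ Q ψ u c μ)
    (hu : Q.parent u ∉ desc Q u) (hadj : G.Adj c (lam (Q.parent u))) :
    IsMatch G φ Q ψ ((desc Q u).piecewise μ lam) := by
  obtain ⟨hc, hlabel, hedge⟩ := hμ
  refine ⟨fun v => ?_, fun v hv => ?_⟩
  · by_cases hvd : v ∈ desc Q u
    · simpa [hvd] using hlabel v hvd
    · simpa [hvd] using hlam.1 v
  · by_cases hvd : v ∈ desc Q u
    · by_cases hvu : v = u
      · subst hvu
        simpa [hvd, hu, hc] using hadj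
      · simpa [hvd, parent_mem_desc Q hvd hvu] using hedge v hvd hvu
    · have hpd : Q.parent v ∉ desc Q u := fun h => hvd (mem_desc_of_parent_mem Q h)
      simpa [hvd, hpd] using hlam.2 v hv

/-- if `q 0 = r, q 1, …, q (j-1) = q` is the path in `Q` from the root
to a query node `q`, and `c 0, …, c (j-1)` are graph nodes with `{c i, c (i+1)} ∈ E`
and a subtree match at each `(q i, c i)`, then there is a complete homomorphic match
`λ` with `λ (q i) = c i` for all `i < j`. -/
theorem stmt2 [Fintype V] [DecidableEq V] [Fintype A] [DecidableEq A]
    (G : SimpleGraph V) (φ : V → L) (Q : QueryTree A) (ψ : A → L)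
    (j : ℕ) (hj : 0 < j) (q : ℕ → A) (c : ℕ → V)
    (hroot : q 0 = Q.root)
    (hpath : ∀ i : ℕ, i + 1 < j → Q.parent (q (i + 1)) = q i ∧ q (i + 1) ≠ Q.root)
    (hadj : ∀ i : ℕ, i + 1 < j → G.Adj (c i) (c (i + 1)))
    (hsub : ∀ i : ℕ, i < j → SubtreeMatchExists G φ Q ψ (q i) (c i)) :
    ∃ lam : A → V, IsMatch G φ Q ψ lam ∧ ∀ i : ℕ, i < j → lam (q i) = c i := by
  obtain ⟨k, rfl⟩ := Nat.exists_eq_succ_of_ne_zero hj.ne'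
  suffices h : ∀ m, m < k + 1 →
      ∃ lam : A → V, IsMatch G φ Q ψ lam ∧ ∀ i, i ≤ m → lam (q i) = c i by
    obtain ⟨lam, hlam, hpin⟩ := h k k.lt_succ_self
    exact ⟨lam, hlam, fun i hi => hpin i (Nat.le_of_lt_succ hi)⟩
  intro m hm
  induction m with
  | zero =>
    obtain ⟨μ, hc, hlabel, hedge⟩ := hsub 0 hj
    have hall : ∀ v, v ∈ desc Q (q 0) := fun v => hroot ▸ Q.reaches v
    refine ⟨μ, ⟨fun u => hlabel u (hall u), fun u hu => hedge u (hall u) (hroot ▸ hu)⟩, ?_⟩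
    intro i hi
    rw [Nat.le_zero.mp hi, hc]
  | succ m ih =>
    obtain ⟨lam, hlam, hpin⟩ := ih (by omega)
    obtain ⟨μ, hμ⟩ := hsub (m + 1) hm
    have hnot : ∀ i, i ≤ m → q i ∉ desc Q (q (m + 1)) := fun i hi =>
      path_notMem_desc Q hroot hpath (Nat.lt_succ_of_le hi) hm
    have hpar := (hpath m hm).1
    refine ⟨(desc Q (q (m + 1))).piecewise μ lam, hlam.piecewise hμ ?_ ?_, fun i hi => ?_⟩
    · rw [hpar]
      exact hnot m le_rfl
    · rw [hpar, hpin m le_rfl]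
      exact (hadj m hm).symm
    · rcases Nat.lt_or_eq_of_le hi with h | rfl
      · rw [Set.piecewise_eq_of_notMem _ _ _ (hnot i (by omega)), hpin i (by omega)]
      · rw [Set.piecewise_eq_of_mem _ _ _ (mem_desc_self Q _), hμ.1]
end
end

section
/- Let G be a labeled weighted graph and Q a rooted query tree with label constraint ψ. Let P be a partial match and P' a successor of P, and suppose P' has at least one complete homomorphic match as a successor. Then the priorities of both P and P' are defined and priority(P) ≤ priority(P'). (The priority value of a partial pattern is always less than or equal to the priority of all its successors.) -/
open Finset
open scoped Classical

noncomputable section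

variable {V L A : Type}

namespace QueryTree

variable (Q : QueryTree A)

theorem iterate_parent_root (n : ℕ) : Q.parent^[n] Q.root = Q.root :=
  Function.iterate_fixed Q.parent_root n

theorem eq_root_of_iterate_parent_eq {k : ℕ} (hk : 0 < k) {v : A} (h : Q.parent^[k] v = v) :
    v = Q.root := by
  obtain ⟨n, hn⟩ := Q.reaches v
  have hper : Q.parent^[k * n] v = v := by
    rw [Function.iterate_mul]
    exact Function.iterate_fixed h n
  obtain ⟨m, hm⟩ := Nat.exists_eq_add_of_le (Nat.le_mul_of_pos_left n hk)
  rw [hm, add_comm, Function.iterate_add_apply, hn, iterate_parent_root] at hper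
  exact hper.symm

theorem self_mem_desc (u : A) : u ∈ desc Q u := ⟨0, rfl⟩

theorem parent_notMem_desc {u : A} (hu : u ≠ Q.root) : Q.parent u ∉ desc Q u := by
  rintro ⟨n, hn⟩
  exact hu (Q.eq_root_of_iterate_parent_eq n.succ_pos hn)

theorem desc_subset_desc_parent (u : A) : desc Q u ⊆ desc Q (Q.parent u) := by
  rintro x ⟨n, rfl⟩
  exact ⟨n + 1, Function.iterate_succ_apply' ..⟩

theorem parent_mem_desc {u x : A} (hx : x ∈ desc Q u) (hne : x ≠ u) : Q.parent x ∈ desc Q u := by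
  obtain ⟨_ | n, hn⟩ := hx
  · exact absurd hn hne
  · exact ⟨n, hn⟩

theorem exists_child_of_mem_desc {v x : A} (hx : x ∈ desc Q v) (hne : x ≠ v) :
    ∃ u, (u ≠ Q.root ∧ Q.parent u = v) ∧ x ∈ desc Q u := by
  obtain ⟨n, hn⟩ := hx
  induction n generalizing x with
  | zero => exact absurd hn hne
  | succ n ih =>
    by_cases hp : Q.parent x = v
    · refine ⟨x, ⟨?_, hp⟩, Q.self_mem_desc x⟩
      rintro rfl
      exact hne (Q.parent_root.symm.trans hp)
    · obtain ⟨u, hu, m, hm⟩ := ih hp hn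
      exact ⟨u, hu, m + 1, hm⟩

theorem child_eq_of_mem_desc {u₁ u₂ x : A} (h₁ : u₁ ≠ Q.root) (h₂ : u₂ ≠ Q.root)
    (hp : Q.parent u₁ = Q.parent u₂) (hx₁ : x ∈ desc Q u₁) (hx₂ : x ∈ desc Q u₂) : u₁ = u₂ := by
  obtain ⟨n, hn⟩ := hx₁
  obtain ⟨m, hm⟩ := hx₂
  wlog hle : n ≤ m generalizing n m u₁ u₂
  · exact (this h₂ h₁ hp.symm m hm n hn (by omega)).symm
  obtain ⟨k, rfl⟩ := Nat.exists_eq_add_of_le hle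
  rw [add_comm, Function.iterate_add_apply, hn] at hm
  cases k with
  | zero => exact hm
  | succ k =>
    have hroot : Q.parent u₁ = Q.root := by
      apply Q.eq_root_of_iterate_parent_eq k.succ_pos
      rw [← Function.iterate_succ_apply, Function.iterate_succ_apply', hm, hp]
    rw [Function.iterate_succ_apply, hroot, iterate_parent_root] at hm
    exact absurd hm.symm h₂

end QueryTree

/-- The children of the query node `v`. -/
def children [Fintype A] [DecidableEq A] (Q : QueryTree A) (v : A) : Finset A :=
  Finset.univ.filter (fun u : A => u ≠ Q.root ∧ Q.parent u = v)

section

variable [Fintype A] [DecidableEq A]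

theorem mem_children {Q : QueryTree A} {u v : A} :
    u ∈ children Q v ↔ u ≠ Q.root ∧ Q.parent u = v := by simp [children]

theorem subtreeWeight_eq_sum_children (w : Sym2 V → ℝ) (Q : QueryTree A) (v : A) (μ : A → V) :
    subtreeWeight w Q v μ =
      ∑ u ∈ children Q v, (w s(μ u, μ v) + subtreeWeight w Q u μ) := by
  have hsplit : Finset.univ.filter (fun x : A => x ∈ desc Q v ∧ x ≠ v) =
      (children Q v).biUnion (fun u => Finset.univ.filter (fun x : A => x ∈ desc Q u)) := by
    ext x
    simp only [mem_filter, mem_univ, true_and, mem_biUnion, mem_children]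
    constructor
    · rintro ⟨hx, hne⟩
      exact Q.exists_child_of_mem_desc hx hne
    · rintro ⟨u, ⟨hu, rfl⟩, hx⟩
      refine ⟨Q.desc_subset_desc_parent u hx, ?_⟩
      rintro rfl
      exact Q.parent_notMem_desc hu hx
  rw [subtreeWeight, hsplit, Finset.sum_biUnion]
  · refine Finset.sum_congr rfl fun u hu => ?_
    obtain ⟨-, rfl⟩ := mem_children.1 hu
    have hins : Finset.univ.filter (fun x : A => x ∈ desc Q u) =
        insert u (Finset.univ.filter (fun x : A => x ∈ desc Q u ∧ x ≠ u)) := by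
      ext x
      by_cases hx : x = u
      · simp [hx, Q.self_mem_desc]
      · simp [hx]
    rw [hins, Finset.sum_insert (by simp), subtreeWeight]
  · intro u₁ h₁ u₂ h₂ hne
    obtain ⟨h₁, hp₁⟩ := mem_children.1 h₁
    obtain ⟨h₂, hp₂⟩ := mem_children.1 h₂
    refine Finset.disjoint_left.2 fun x hx₁ hx₂ => hne ?_
    exact Q.child_eq_of_mem_desc h₁ h₂ (hp₁.trans hp₂.symm)
      (Finset.mem_filter.1 hx₁).2 (Finset.mem_filter.1 hx₂).2

theorem subtreeWeight_congr (w : Sym2 V → ℝ) (Q : QueryTree A) (u : A) {μ ν : A → V}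
    (h : ∀ x ∈ desc Q u, μ x = ν x) : subtreeWeight w Q u μ = subtreeWeight w Q u ν := by
  refine Finset.sum_congr rfl fun x hx => ?_
  obtain ⟨hx, hne⟩ := (Finset.mem_filter.1 hx).2
  rw [h x hx, h _ (Q.parent_mem_desc hx hne)]

/-- Subtree matches at the children of `v` glue to a map that sends `v` to a given vertex. -/
theorem exists_glue (Q : QueryTree A) (v : A) (c : V) (μ : A → A → V) :
    ∃ ν : A → V, ν v = c ∧ ∀ u ∈ children Q v, ∀ x ∈ desc Q u, ν x = μ u x := by
  refine ⟨fun x => if h : ∃ u ∈ children Q v, x ∈ desc Q u then μ h.choose x else c, ?_, ?_⟩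
  · refine dif_neg ?_
    rintro ⟨u, hu, hv⟩
    obtain ⟨hur, rfl⟩ := mem_children.1 hu
    exact Q.parent_notMem_desc hur hv
  · intro u hu x hx
    have h : ∃ u ∈ children Q v, x ∈ desc Q u := ⟨u, hu, hx⟩
    obtain ⟨h₁, hx₁⟩ := h.choose_spec
    obtain ⟨h₁, hp₁⟩ := mem_children.1 h₁
    obtain ⟨h₂, hp₂⟩ := mem_children.1 hu
    have heq : h.choose = u :=
      Q.child_eq_of_mem_desc h₁ h₂ (hp₁.trans hp₂.symm) hx₁ hx
    simp only [dif_pos h, heq]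

variable {G : SimpleGraph V} {φ : V → L} {w : Sym2 V → ℝ} {Q : QueryTree A} {ψ : A → L}

theorem IsMatch.isSubtreeMatch {lam : A → V} (h : IsMatch G φ Q ψ lam) {u : A} (hu : u ≠ Q.root) :
    IsSubtreeMatch G φ Q ψ u (lam u) lam := by
  refine ⟨rfl, fun x _ => h.1 x, fun x hx hne => h.2 x ?_⟩
  rintro rfl
  obtain ⟨n, hn⟩ := hx
  exact hu (hn.symm.trans (Q.iterate_parent_root n))

theorem IsMatch.mem_candSet {lam : A → V} (h : IsMatch G φ Q ψ lam) {u : A} (hu : u ≠ Q.root) :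
    w s(lam (Q.parent u), lam u) + minW G φ w Q ψ u (lam u) ∈
      candSet G φ w Q ψ (lam (Q.parent u)) u :=
  ⟨lam u, (h.2 u hu).symm, h.1 u, ⟨lam, h.isSubtreeMatch hu⟩, rfl⟩

theorem IsRootedPrefix.ne_root_of_mem_boundary {S : Finset A} (hS : IsRootedPrefix Q S) {u : A}
    (hu : u ∈ boundary Q S) : u ≠ Q.root := by
  rintro rfl
  exact (Finset.mem_filter.1 hu).2.1 hS.1

theorem IsRootedPrefix.insert_of_mem_boundary {S : Finset A} (hS : IsRootedPrefix Q S) {v : A}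
    (hv : v ∈ boundary Q S) : IsRootedPrefix Q (insert v S) := by
  refine ⟨mem_insert_of_mem hS.1, fun x hx => mem_insert_of_mem ?_⟩
  rcases mem_insert.1 hx with rfl | hx
  · exact (Finset.mem_filter.1 hv).2.2
  · exact hS.2 x hx

theorem IsRootedPrefix.boundary_insert {S : Finset A} (hS : IsRootedPrefix Q S) {v : A}
    (hv : v ∈ boundary Q S) : boundary Q (insert v S) = (boundary Q S).erase v ∪ children Q v := by
  have hvr := hS.ne_root_of_mem_boundary hv
  obtain ⟨hvS, hpv⟩ := (Finset.mem_filter.1 hv).2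
  ext x
  simp only [boundary, mem_union, mem_erase, mem_filter, mem_univ, true_and, mem_children,
    mem_insert, not_or]
  constructor
  · rintro ⟨⟨hxv, hxS⟩, hp | hp⟩
    · exact Or.inr ⟨fun hx => hxS (hx ▸ hS.1), hp⟩
    · exact Or.inl ⟨hxv, hxS, hp⟩
  · rintro (⟨hxv, hxS, hp⟩ | ⟨hxr, rfl⟩)
    · exact ⟨⟨hxv, hxS⟩, Or.inr hp⟩
    · refine ⟨⟨fun hx => hvS ?_, fun hx => hvS (hS.2 x hx)⟩, Or.inl rfl⟩
      rwa [← hx] at hpv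

theorem disjoint_boundary_children {S : Finset A} {v : A} (hvS : v ∉ S) :
    Disjoint ((boundary Q S).erase v) (children Q v) := by
  refine Finset.disjoint_left.2 fun x hx hxc => hvS ?_
  rw [← (mem_children.1 hxc).2]
  exact (Finset.mem_filter.1 (mem_of_mem_erase hx)).2.2

theorem IsRootedPrefix.exists_mem_boundary {S S' : Finset A} (hS : IsRootedPrefix Q S)
    (hS' : IsRootedPrefix Q S') (hne : ¬ S' ⊆ S) : ∃ v ∈ boundary Q S, v ∈ S' := by
  obtain ⟨x, hx', hx⟩ := Finset.not_subset.1 hne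
  obtain ⟨n, hn⟩ := Q.reaches x
  induction n generalizing x with
  | zero => exact absurd (show x ∈ S from (show x = Q.root from hn) ▸ hS.1) hx
  | succ n ih =>
    by_cases hp : Q.parent x ∈ S
    · exact ⟨x, by simp [boundary, hx, hp], hx'⟩
    · exact ih _ (hS'.2 x hx') hp hn

theorem priorityVal_congr {S : Finset A} (hS : IsRootedPrefix Q S) {P P' : A → V}
    (h : ∀ u ∈ S, P u = P' u) : priorityVal G φ w Q ψ S P = priorityVal G φ w Q ψ S P' := by
  refine congrArg₂ (· + ·) (Finset.sum_congr rfl fun u hu => ?_) (Finset.sum_congr rfl fun u hu => ?_)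
  · have hu := (Finset.mem_filter.1 hu).1
    rw [h u hu, h _ (hS.2 u hu)]
  · rw [h _ (Finset.mem_filter.1 hu).2.2]

theorem candSet_nonempty_of_mem_boundary {S : Finset A} (hS : IsRootedPrefix Q S) {P lam : A → V}
    (h : IsMatch G φ Q ψ lam) (hP : ∀ u ∈ S, lam u = P u) {u : A} (hu : u ∈ boundary Q S) :
    (candSet G φ w Q ψ (P (Q.parent u)) u).Nonempty := by
  rw [← hP _ (Finset.mem_filter.1 hu).2.2]
  exact ⟨_, h.mem_candSet (hS.ne_root_of_mem_boundary hu)⟩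

variable [Fintype V]

theorem finite_subtreeWeights (u : A) (c : V) :
    {x : ℝ | ∃ μ : A → V, IsSubtreeMatch G φ Q ψ u c μ ∧ subtreeWeight w Q u μ = x}.Finite :=
  (Set.finite_range (subtreeWeight w Q u)).subset fun _ ⟨μ, _, h⟩ => ⟨μ, h⟩

theorem minW_le {u : A} {c : V} {μ : A → V} (h : IsSubtreeMatch G φ Q ψ u c μ) :
    minW G φ w Q ψ u c ≤ subtreeWeight w Q u μ :=
  csInf_le (finite_subtreeWeights u c).bddBelow ⟨μ, h, rfl⟩

theorem exists_subtreeWeight_eq_minW {u : A} {c : V} (h : SubtreeMatchExists G φ Q ψ u c) :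
    ∃ μ, IsSubtreeMatch G φ Q ψ u c μ ∧ subtreeWeight w Q u μ = minW G φ w Q ψ u c := by
  obtain ⟨μ, hμ⟩ := h
  have hne : {x : ℝ | ∃ μ : A → V,
      IsSubtreeMatch G φ Q ψ u c μ ∧ subtreeWeight w Q u μ = x}.Nonempty := ⟨_, μ, hμ, rfl⟩
  exact hne.csInf_mem (finite_subtreeWeights u c)

theorem finite_candSet (c : V) (u : A) : (candSet G φ w Q ψ c u).Finite :=
  (Set.finite_range fun c' => w s(c, c') + minW G φ w Q ψ u c').subset
    fun _ ⟨c', _, _, _, h⟩ => ⟨c', h.symm⟩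

theorem exists_subtreeMatch_eq_sInf_candSet {u : A} {c : V}
    (h : (candSet G φ w Q ψ c u).Nonempty) :
    ∃ μ : A → V, IsSubtreeMatch G φ Q ψ u (μ u) μ ∧ G.Adj (μ u) c ∧
      sInf (candSet G φ w Q ψ c u) = w s(μ u, c) + subtreeWeight w Q u μ := by
  obtain ⟨c', hadj, -, hex, heq⟩ := h.csInf_mem (finite_candSet c u)
  obtain ⟨μ, hμ, hw⟩ := exists_subtreeWeight_eq_minW (w := w) hex
  obtain rfl := hμ.1
  exact ⟨μ, hμ, hadj.symm, by rw [heq, hw, Sym2.eq_swap]⟩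

/-- The minimum subtree weight at `(v, c)` is at most the sum, over the children of `v`, of the
minimal cost of extending a match along that child. -/
theorem minW_le_sum_children {v : A} {c : V} (hc : φ c = ψ v)
    (hne : ∀ u ∈ children Q v, (candSet G φ w Q ψ c u).Nonempty) :
    minW G φ w Q ψ v c ≤ ∑ u ∈ children Q v, sInf (candSet G φ w Q ψ c u) := by
  have hex : ∀ u, ∃ μ : A → V, u ∈ children Q v → IsSubtreeMatch G φ Q ψ u (μ u) μ ∧
      G.Adj (μ u) c ∧ sInf (candSet G φ w Q ψ c u) = w s(μ u, c) + subtreeWeight w Q u μ := by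
    intro u
    by_cases hu : u ∈ children Q v
    · obtain ⟨μ, hμ⟩ := exists_subtreeMatch_eq_sInf_candSet (hne u hu)
      exact ⟨μ, fun _ => hμ⟩
    · exact ⟨fun _ => c, fun h => absurd h hu⟩
  choose μ hμ using hex
  obtain ⟨ν, hνv, hν⟩ := exists_glue Q v c μ
  have hmatch : IsSubtreeMatch G φ Q ψ v c ν := by
    refine ⟨hνv, fun x hx => ?_, fun x hx hxv => ?_⟩
    · by_cases hxv : x = v
      · rw [hxv, hνv, hc]
      · obtain ⟨u, hu, hxu⟩ := Q.exists_child_of_mem_desc hx hxv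
        rw [hν u (mem_children.2 hu) x hxu]
        exact (hμ u (mem_children.2 hu)).1.2.1 x hxu
    · obtain ⟨u, hu, hxu⟩ := Q.exists_child_of_mem_desc hx hxv
      have hu' := mem_children.2 hu
      rw [hν u hu' x hxu]
      by_cases hxeq : x = u
      · rw [hxeq, hu.2, hνv]
        exact (hμ u hu').2.1
      · rw [hν u hu' _ (Q.parent_mem_desc hxu hxeq)]
        exact (hμ u hu').1.2.2 x hxu hxeq
  refine (minW_le hmatch).trans_eq ?_
  rw [subtreeWeight_eq_sum_children]
  refine Finset.sum_congr rfl fun u hu => ?_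
  rw [hνv, hν u hu u (Q.self_mem_desc u), subtreeWeight_congr w Q u (hν u hu), (hμ u hu).2.2]

theorem priorityVal_le_insert {S : Finset A} (hS : IsRootedPrefix Q S) {v : A}
    (hv : v ∈ boundary Q S) {lam : A → V} (h : IsMatch G φ Q ψ lam) :
    priorityVal G φ w Q ψ S lam ≤ priorityVal G φ w Q ψ (insert v S) lam := by
  have hvr := hS.ne_root_of_mem_boundary hv
  have hvS : v ∉ S := (Finset.mem_filter.1 hv).2.1
  have hstep : sInf (candSet G φ w Q ψ (lam (Q.parent v)) v) ≤
      w s(lam v, lam (Q.parent v)) +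
        ∑ u ∈ children Q v, sInf (candSet G φ w Q ψ (lam (Q.parent u)) u) := by
    refine (csInf_le (finite_candSet _ v).bddBelow (h.mem_candSet hvr)).trans ?_
    rw [Sym2.eq_swap]
    gcongr
    refine (minW_le_sum_children (h.1 v) fun u hu => ?_).trans_eq
      (Finset.sum_congr rfl fun u hu => by rw [(mem_children.1 hu).2])
    obtain ⟨hur, rfl⟩ := mem_children.1 hu
    exact ⟨_, h.mem_candSet hur⟩
  rw [priorityVal, priorityVal, hS.boundary_insert hv,
    Finset.sum_union (disjoint_boundary_children hvS), Finset.filter_insert,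
    if_pos hvr, Finset.sum_insert (by simp [hvS]), ← Finset.add_sum_erase _ _ hv]
  linarith

theorem priorityVal_mono {S S' : Finset A} (hS : IsRootedPrefix Q S) (hS' : IsRootedPrefix Q S')
    (hsub : S ⊆ S') {lam : A → V} (h : IsMatch G φ Q ψ lam) :
    priorityVal G φ w Q ψ S lam ≤ priorityVal G φ w Q ψ S' lam := by
  induction hk : (S' \ S).card using Nat.strong_induction_on generalizing S with
  | _ k ih =>
    by_cases hle : S' ⊆ S
    · rw [hsub.antisymm hle]
    · obtain ⟨v, hv, hv'⟩ := hS.exists_mem_boundary hS' hle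
      have hvS : v ∉ S := (Finset.mem_filter.1 hv).2.1
      refine (priorityVal_le_insert hS hv h).trans
        (ih _ ?_ (hS.insert_of_mem_boundary hv) (insert_subset hv' hsub) rfl)
      rw [← hk]
      exact card_lt_card (Finset.ssubset_iff_of_subset
        (sdiff_subset_sdiff subset_rfl (subset_insert v S)) |>.2 ⟨v, by simp [hv', hvS]⟩)

end

/-- if `P'` is a successor of the partial match `P` and `P'` has at least
one complete homomorphic match as a successor, then the priorities of both `P` and `P'`
are defined and `priority(P) ≤ priority(P')`. -/
theorem stmt6 [Fintype V] [DecidableEq V] [Fintype A] [DecidableEq A]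
    (G : SimpleGraph V) (φ : V → L) (w : Sym2 V → ℝ) (Q : QueryTree A) (ψ : A → L)
    (S S' : Finset A) (hS : IsRootedPrefix Q S) (hS' : IsRootedPrefix Q S')
    (P P' : A → V)
    (hP : IsPartialMatch G φ Q ψ S P) (hP' : IsPartialMatch G φ Q ψ S' P')
    (hsub : S ⊆ S') (hagree : ∀ u ∈ S, P' u = P u)
    (hex : ∃ lam : A → V, IsMatch G φ Q ψ lam ∧ ∀ u ∈ S', lam u = P' u) :
    (∀ u' ∈ boundary Q S, (candSet G φ w Q ψ (P (Q.parent u')) u').Nonempty) ∧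
    (∀ u' ∈ boundary Q S', (candSet G φ w Q ψ (P' (Q.parent u')) u').Nonempty) ∧
    priorityVal G φ w Q ψ S P ≤ priorityVal G φ w Q ψ S' P' := by
  obtain ⟨lam, hlam, hlam'⟩ := hex
  have hlamS : ∀ u ∈ S, lam u = P u := fun u hu => (hlam' u (hsub hu)).trans (hagree u hu)
  refine ⟨fun u hu => candSet_nonempty_of_mem_boundary hS hlam hlamS hu,
    fun u hu => candSet_nonempty_of_mem_boundary hS' hlam hlam' hu, ?_⟩
  rw [← priorityVal_congr hS hlamS, ← priorityVal_congr hS' hlam']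
  exact priorityVal_mono hS hS' hsub hlam
end
end

section
/- Let G be a labeled weighted graph and Q a rooted query tree with label constraint ψ, and let r_H denote the number of complete homomorphic matches of Q in G. At every state reachable in any run of the front-element-optimized best-first search process, the number of elements of the multiset B (counted with multiplicity) is at most r_H. (Space cost of the prioritized search is upper bounded by the total result size for sub-graph homomorphism.) -/
open Finset
open scoped Classical

noncomputable section

variable {V L A : Type}

variable [Fintype V] [DecidableEq V] [Fintype A] [DecidableEq A]

/-- A partial-match candidate: a set of query nodes together with an assignment. -/
abbrev PM (V A : Type) := Finset A × (A → V)

/-- A viable partial match: a partial match on a rooted prefix that has at least one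
complete homomorphic match as a successor. -/
def Viable (G : SimpleGraph V) (φ : V → L) (Q : QueryTree A) (ψ : A → L)
    (pm : PM V A) : Prop :=
  IsRootedPrefix Q pm.1 ∧ IsPartialMatch G φ Q ψ pm.1 pm.2 ∧
    ∃ lam : A → V, IsMatch G φ Q ψ lam ∧ ∀ u ∈ pm.1, lam u = pm.2 u

/-- A preorder (DFS) traversal of the rooted tree `Q`: an injective numbering in which
every non-root node comes after its parent and every subtree is contiguous. -/
structure DfsOrder {A : Type} (Q : QueryTree A) : Type where
  ord : A → ℕ
  inj : Function.Injective ord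
  parent_lt : ∀ v : A, v ≠ Q.root → ord (Q.parent v) < ord v
  contiguous : ∀ u v x : A, v ∈ desc Q u → ord u ≤ ord x → ord x ≤ ord v → x ∈ desc Q u

/-- The next query node for a non-complete partial match on `S`: the first node of the
boundary `∂S` in the fixed preorder. -/
def nextNode (Q : QueryTree A) (D : DfsOrder Q) (S : Finset A) : A :=
  if h : (boundary Q S).Nonempty then
    Classical.choose (Finset.exists_min_image (boundary Q S) D.ord h)
  else Q.root

/-- The viable direct successors of `pm` obtained by assigning some graph node to the
next query node. -/
def extOptionsF (G : SimpleGraph V) (φ : V → L) (Q : QueryTree A) (ψ : A → L)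
    (D : DfsOrder Q) (pm : PM V A) : Finset (PM V A) :=
  Finset.univ.filter (fun pm' : PM V A =>
    ∃ c' : V, pm'.1 = insert (nextNode Q D pm.1) pm.1 ∧
      pm'.2 = Function.update pm.2 (nextNode Q D pm.1) c' ∧
      Viable G φ Q ψ pm')

/-- `ExtendsTo pm ins t final`: starting from the popped partial match `pm`, the inner
loop of a macro-step performs `t` extension steps, each time retaining a viable direct
successor of minimum priority at the next query node and inserting all the other viable
direct successors (collected in the multiset `ins`), until the retained partial match
`final` is complete. -/
inductive ExtendsTo (G : SimpleGraph V) (φ : V → L) (w : Sym2 V → ℝ)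
    (Q : QueryTree A) (ψ : A → L) (D : DfsOrder Q) :
    PM V A → Multiset (PM V A) → ℕ → PM V A → Prop
  | done (pm : PM V A) (h : pm.1 = Finset.univ) : ExtendsTo G φ w Q ψ D pm 0 0 pm
  | step (pm pm' final : PM V A) (ins : Multiset (PM V A)) (t : ℕ)
      (hne : pm.1 ≠ Finset.univ)
      (hmem : pm' ∈ extOptionsF G φ Q ψ D pm)
      (hmin : ∀ q ∈ extOptionsF G φ Q ψ D pm,
        priorityVal G φ w Q ψ pm'.1 pm'.2 ≤ priorityVal G φ w Q ψ q.1 q.2)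
      (hrest : ExtendsTo G φ w Q ψ D pm' ins t final) :
      ExtendsTo G φ w Q ψ D pm
        (((extOptionsF G φ Q ψ D pm).erase pm').val + ins) (t + 1) final

/-- A state of the front-element-optimized best-first search process: the multiset `B`
of stored partial matches together with the output sequence of complete matches. -/
abbrev SearchState (V A : Type) := Multiset (PM V A) × List (A → V)

/-- A macro-step of the process: remove from `B` a partial match of minimum priority,
extend it (front-element optimization) to a complete match, insert the bypassed viable
direct successors into `B`, and append the complete match to the output. -/
def StepRel (G : SimpleGraph V) (φ : V → L) (w : Sym2 V → ℝ)
    (Q : QueryTree A) (ψ : A → L) (D : DfsOrder Q)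
    (s s' : SearchState V A) : Prop :=
  ∃ (pm final : PM V A) (ins : Multiset (PM V A)) (t : ℕ),
    pm ∈ s.1 ∧
    (∀ q ∈ s.1, priorityVal G φ w Q ψ pm.1 pm.2 ≤ priorityVal G φ w Q ψ q.1 q.2) ∧
    ExtendsTo G φ w Q ψ D pm ins t final ∧
    s'.1 = s.1.erase pm + ins ∧ s'.2 = s.2 ++ [final.2]

/-- The multiset `B` of the initial state: all viable one-node partial matches
`r ↦ c`. -/
def initB (G : SimpleGraph V) (φ : V → L) (Q : QueryTree A) (ψ : A → L) :
    Multiset (PM V A) :=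
  ((Finset.univ.filter (fun c : V =>
      Viable G φ Q ψ (({Q.root} : Finset A), Function.const A c))).val).map
    (fun c : V => (({Q.root} : Finset A), Function.const A c))

/-- The states reachable by a run of the process from the initial state. -/
def ReachableState (G : SimpleGraph V) (φ : V → L) (w : Sym2 V → ℝ)
    (Q : QueryTree A) (ψ : A → L) (D : DfsOrder Q) (s : SearchState V A) : Prop :=
  Relation.ReflTransGen (StepRel G φ w Q ψ D) (initB G φ Q ψ, ([] : List (A → V))) s

/-- The number of complete homomorphic matches of `Q` in `G` (`r_H`). -/
def rH (G : SimpleGraph V) (φ : V → L) (Q : QueryTree A) (ψ : A → L) : ℕ :=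
  (Finset.univ.filter (fun lam : A → V => IsMatch G φ Q ψ lam)).card

/-- The complete matches that are successors of the partial match `pm`. -/
def completions (G : SimpleGraph V) (φ : V → L) (Q : QueryTree A) (ψ : A → L)
    (pm : PM V A) : Finset (A → V) :=
  Finset.univ.filter (fun lam : A → V => IsMatch G φ Q ψ lam ∧ ∀ u ∈ pm.1, lam u = pm.2 u)

theorem Viable.one_le_card_completions {G : SimpleGraph V} {φ : V → L} {Q : QueryTree A}
    {ψ : A → L} {pm : PM V A} (h : Viable G φ Q ψ pm) :
    1 ≤ (completions G φ Q ψ pm).card := by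
  obtain ⟨-, -, lam, hlam, hag⟩ := h
  exact Finset.card_pos.mpr ⟨lam, by simp [completions, hlam]; exact hag⟩

theorem boundary_nonempty {Q : QueryTree A} {S : Finset A} (hS : Q.root ∈ S)
    (hne : S ≠ Finset.univ) : (boundary Q S).Nonempty := by
  obtain ⟨v, hv⟩ : ∃ v, v ∉ S := by
    by_contra! hall
    exact hne (Finset.eq_univ_iff_forall.mpr hall)
  obtain ⟨n, hn⟩ := Q.reaches v
  induction n generalizing v with
  | zero => exact absurd ((show v = Q.root from hn) ▸ hS) hv
  | succ n ih =>
    by_cases hp : Q.parent v ∈ S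
    · exact ⟨v, by simp [boundary, hv, hp]⟩
    · exact ih _ hp (by simpa [Function.iterate_succ_apply] using hn)

theorem nextNode_notMem {Q : QueryTree A} (D : DfsOrder Q) {S : Finset A} (hS : Q.root ∈ S)
    (hne : S ≠ Finset.univ) : nextNode Q D S ∉ S := by
  have hb := boundary_nonempty hS hne
  have hmem := (Classical.choose_spec (Finset.exists_min_image (boundary Q S) D.ord hb)).1
  rw [nextNode, dif_pos hb]
  exact (Finset.mem_filter.mp hmem).2.1

/-- The viable direct successors of a partial match split its completions among them. -/
theorem sum_card_completions_extOptionsF_le (G : SimpleGraph V) (φ : V → L) (Q : QueryTree A)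
    (ψ : A → L) (D : DfsOrder Q) (pm : PM V A) (hnext : nextNode Q D pm.1 ∉ pm.1) :
    ∑ q ∈ extOptionsF G φ Q ψ D pm, (completions G φ Q ψ q).card ≤
      (completions G φ Q ψ pm).card := by
  rw [← Finset.card_biUnion]
  · refine Finset.card_le_card fun lam hlam => ?_
    obtain ⟨q, hq, hlam⟩ := Finset.mem_biUnion.mp hlam
    obtain ⟨c, hc₁, hc₂, -⟩ := (Finset.mem_filter.mp hq).2
    obtain ⟨hmatch, hag⟩ := (Finset.mem_filter.mp hlam).2
    refine Finset.mem_filter.mpr ⟨Finset.mem_univ _, hmatch, fun u hu => ?_⟩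
    rw [hag u (hc₁ ▸ Finset.mem_insert_of_mem hu), hc₂,
      Function.update_of_ne (ne_of_mem_of_not_mem hu hnext)]
  · intro q hq q' hq' hne
    obtain ⟨c, hc₁, hc₂, -⟩ := (Finset.mem_filter.mp hq).2
    obtain ⟨c', hc₁', hc₂', -⟩ := (Finset.mem_filter.mp hq').2
    refine Finset.disjoint_left.mpr fun lam hlam hlam' => hne ?_
    have h := (Finset.mem_filter.mp hlam).2.2 _ (hc₁ ▸ Finset.mem_insert_self _ _)
    have h' := (Finset.mem_filter.mp hlam').2.2 _ (hc₁' ▸ Finset.mem_insert_self _ _)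
    rw [hc₂, Function.update_self] at h
    rw [hc₂', Function.update_self] at h'
    exact Prod.ext (hc₁.trans hc₁'.symm) (by rw [hc₂, hc₂', ← h, ← h'])

/-- The partial matches inserted while extending `pm` are viable, and their completions
number at most those of `pm`. -/
theorem ExtendsTo.viable_and_sum_le {G : SimpleGraph V} {φ : V → L} {w : Sym2 V → ℝ}
    {Q : QueryTree A} {ψ : A → L} {D : DfsOrder Q} {pm final : PM V A}
    {ins : Multiset (PM V A)} {t : ℕ} (h : ExtendsTo G φ w Q ψ D pm ins t final)
    (hv : Viable G φ Q ψ pm) :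
    (∀ q ∈ ins, Viable G φ Q ψ q) ∧
      (ins.map fun q => (completions G φ Q ψ q).card).sum ≤ (completions G φ Q ψ pm).card := by
  induction h with
  | done pm h => simp
  | step pm pm' final ins t hne hmem hmin hrest ih =>
    have hopt : ∀ q ∈ extOptionsF G φ Q ψ D pm, Viable G φ Q ψ q := fun q hq =>
      (Finset.mem_filter.mp hq).2.choose_spec.2.2
    obtain ⟨ih₁, ih₂⟩ := ih (hopt _ hmem)
    refine ⟨fun q hq => ?_, ?_⟩
    · rcases Multiset.mem_add.mp hq with hq | hq
      · exact hopt q (Finset.mem_of_mem_erase hq)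
      · exact ih₁ q hq
    · have hsum := sum_card_completions_extOptionsF_le G φ Q ψ D pm
        (nextNode_notMem D hv.1.1 hne)
      rw [← Finset.sum_erase_add _ _ hmem] at hsum
      rw [Multiset.map_add, Multiset.sum_add]
      exact (Nat.add_le_add_left ih₂ _).trans hsum

theorem sum_card_completions_initB_le (G : SimpleGraph V) (φ : V → L) (Q : QueryTree A)
    (ψ : A → L) :
    ((initB G φ Q ψ).map fun q => (completions G φ Q ψ q).card).sum ≤ rH G φ Q ψ := by
  rw [initB, Multiset.map_map]
  change ∑ c ∈ Finset.univ.filter (fun c : V =>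
      Viable G φ Q ψ (({Q.root} : Finset A), Function.const A c)),
    (completions G φ Q ψ (({Q.root} : Finset A), Function.const A c)).card ≤ _
  rw [← Finset.card_biUnion]
  · refine Finset.card_le_card fun lam hlam => ?_
    obtain ⟨c, -, hlam⟩ := Finset.mem_biUnion.mp hlam
    exact Finset.mem_filter.mpr ⟨Finset.mem_univ _, (Finset.mem_filter.mp hlam).2.1⟩
  · intro c _ c' _ hne
    refine Finset.disjoint_left.mpr fun lam hlam hlam' => hne ?_
    have h := (Finset.mem_filter.mp hlam).2.2 Q.root (Finset.mem_singleton_self _)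
    have h' := (Finset.mem_filter.mp hlam').2.2 Q.root (Finset.mem_singleton_self _)
    exact h.symm.trans h'

/-- In every reachable state all stored partial matches are viable, and the numbers of their
completions sum to at most `r_H`. -/
theorem ReachableState.viable_and_sum_le {G : SimpleGraph V} {φ : V → L} {w : Sym2 V → ℝ}
    {Q : QueryTree A} {ψ : A → L} {D : DfsOrder Q} {s : SearchState V A}
    (h : ReachableState G φ w Q ψ D s) :
    (∀ q ∈ s.1, Viable G φ Q ψ q) ∧
      (s.1.map fun q => (completions G φ Q ψ q).card).sum ≤ rH G φ Q ψ := by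
  induction h with
  | refl =>
    refine ⟨fun q hq => ?_, sum_card_completions_initB_le G φ Q ψ⟩
    obtain ⟨c, hc, rfl⟩ := Multiset.mem_map.mp hq
    exact (Finset.mem_filter.mp hc).2
  | tail _ hstep ih =>
    obtain ⟨pm, final, ins, t, hmem, -, hext, hB, -⟩ := hstep
    obtain ⟨hv, hsum⟩ := hext.viable_and_sum_le (ih.1 pm hmem)
    rw [hB]
    refine ⟨fun q hq => ?_, ?_⟩
    · rcases Multiset.mem_add.mp hq with hq | hq
      · exact ih.1 q (Multiset.mem_of_mem_erase hq)
      · exact hv q hq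
    · have hle := ih.2
      rw [← Multiset.cons_erase hmem, Multiset.map_cons, Multiset.sum_cons] at hle
      rw [Multiset.map_add, Multiset.sum_add]
      omega

/-- at every state reachable in any run of the front-element-optimized
best-first search process, the number of elements of the multiset `B` (counted with
multiplicity) is at most `r_H`. -/
theorem stmt11 (G : SimpleGraph V) (φ : V → L) (w : Sym2 V → ℝ)
    (Q : QueryTree A) (ψ : A → L) (D : DfsOrder Q)
    (s : SearchState V A) (h : ReachableState G φ w Q ψ D s) :
    Multiset.card s.1 ≤ rH G φ Q ψ := by
  obtain ⟨hv, hsum⟩ := h.viable_and_sum_le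
  refine le_trans ?_ hsum
  have hcard := Multiset.card_nsmul_le_sum
    (s := s.1.map fun q => (completions G φ Q ψ q).card) (a := 1) (by
      intro x hx
      obtain ⟨q, hq, rfl⟩ := Multiset.mem_map.mp hx
      exact (hv q hq).one_le_card_completions)
  simpa using hcard

end
end
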